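/- arXiv:1305.2520 — 2 statements merged into one kernel-verified Lean document; each statement's English description precedes it below -/
import Mathlib

section
/- For every complex number s with Re s > 1, ∑_{n=1}^{∞} Λ(n)²/n^s = ∑_{m=1}^{∞} b_m (ζ'/ζ)'(ms), where the series on the right converges absolutely. -/
open Complex

/-- The radical (squarefree kernel) of a natural number: the product of its prime factors. -/
def Nat.rad (m : ℕ) : ℕ := ∏ p ∈ m.primeFactors, p

/-- `b m = μ(rad m) · φ(rad m)`. -/
noncomputable def bcoef (m : ℕ) : ℤ :=
  ArithmeticFunction.moebius m.rad * (Nat.totient m.rad : ℤ)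

/-- `(ζ'/ζ)'`, the derivative of the logarithmic derivative of the Riemann zeta function. -/
noncomputable def zetaLogDerivDeriv (s : ℂ) : ℂ :=
  deriv (fun z => deriv riemannZeta z / riemannZeta z) s

open ArithmeticFunction in
lemma bcoef_eq_prodPrimeFactors {m : ℕ} (hm : m ≠ 0) :
    bcoef m = prodPrimeFactors (fun p => 1 - (p : ℤ)) m := by
  have hprime : ∀ p ∈ m.primeFactors, p.Prime := fun p hp => Nat.prime_of_mem_primeFactors hp
  have hpf : m.rad.primeFactors = m.primeFactors := Nat.primeFactors_prod hprime
  have hrad : m.rad ≠ 0 := Finset.prod_ne_zero_iff.mpr fun p hp => (hprime p hp).ne_zero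
  have htot : m.rad.totient = ∏ p ∈ m.primeFactors, (p - 1) := by
    have h := Nat.totient_mul_prod_primeFactors m.rad
    rw [hpf, mul_comm] at h
    exact Nat.eq_of_mul_eq_mul_left (Nat.pos_of_ne_zero hrad) h
  have hmu : moebius m.rad = ∏ p ∈ m.primeFactors, (-1 : ℤ) :=
    (isMultiplicative_moebius.map_prod_of_prime _ hprime).trans
      (Finset.prod_congr rfl fun p hp => moebius_apply_prime (hprime p hp))
  rw [bcoef, htot, hmu, prodPrimeFactors_apply hm, Nat.cast_prod, ← Finset.prod_mul_distrib]
  refine Finset.prod_congr rfl fun p hp => ?_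
  rw [Nat.cast_sub (hprime p hp).one_le]
  push_cast
  ring

lemma abs_bcoef_le {m : ℕ} (hm : m ≠ 0) : |bcoef m| ≤ m := by
  have hmu : |ArithmeticFunction.moebius m.rad| ≤ 1 := ArithmeticFunction.abs_moebius_le_one
  have hrad : m.rad ≤ m := Nat.le_of_dvd (Nat.pos_of_ne_zero hm) (Nat.prod_primeFactors_dvd m)
  have htot : (m.rad.totient : ℤ) ≤ m := by exact_mod_cast (Nat.totient_le _).trans hrad
  rw [bcoef, abs_mul, Nat.abs_cast]
  calc _ ≤ 1 * (m.rad.totient : ℤ) := by gcongr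
    _ ≤ m := by rwa [one_mul]

open ArithmeticFunction in
lemma prodPrimeFactors_one_sub_mul_id :
    prodPrimeFactors (fun p => 1 - (p : ℤ)) * ((ArithmeticFunction.id : ArithmeticFunction ℕ) :
      ArithmeticFunction ℤ) = ((zeta : ArithmeticFunction ℕ) : ArithmeticFunction ℤ) := by
  refine (IsMultiplicative.eq_iff_eq_on_prime_powers _
    ((IsMultiplicative.prodPrimeFactors _).mul isMultiplicative_id.natCast) _
    isMultiplicative_zeta.natCast).mpr fun p k hp => ?_
  have hpk : p ^ k ≠ 0 := pow_ne_zero _ hp.ne_zero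
  have hterm : ∀ j ∈ Finset.range k,
      prodPrimeFactors (fun p => 1 - (p : ℤ)) (p ^ k / p ^ j) * ((p ^ j : ℕ) : ℤ) =
        p ^ j * (1 - (p : ℤ)) := by
    intro j hj
    have hjk := Finset.mem_range.mp hj
    rw [Nat.pow_div hjk.le hp.pos, prodPrimeFactors_apply (pow_ne_zero _ hp.ne_zero),
      Nat.primeFactors_prime_pow (Nat.sub_ne_zero_of_lt hjk) hp, Finset.prod_singleton,
      Nat.cast_pow, mul_comm]
  simp only [mul_apply, natCoe_apply, id_apply, zeta_apply_ne hpk]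
  rw [Nat.sum_divisorsAntidiagonal' fun x y => prodPrimeFactors (fun p => 1 - (p : ℤ)) x * (y : ℤ),
    Nat.sum_divisors_prime_pow hp, Finset.sum_range_succ, Finset.sum_congr rfl hterm,
    ← Finset.sum_mul, Nat.div_self (Nat.pos_of_ne_zero hpk),
    (IsMultiplicative.prodPrimeFactors _).map_one]
  have := geom_sum_mul (p : ℤ) k
  push_cast
  linarith

lemma sum_divisorsAntidiagonal_bcoef_mul {k : ℕ} (hk : k ≠ 0) :
    ∑ x ∈ k.divisorsAntidiagonal, bcoef x.1 * (x.2 : ℤ) = 1 := by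
  have h := congrArg (fun f : ArithmeticFunction ℤ => f k) prodPrimeFactors_one_sub_mul_id
  simp only [ArithmeticFunction.mul_apply, ArithmeticFunction.natCoe_apply,
    ArithmeticFunction.id_apply, ArithmeticFunction.zeta_apply_ne hk, Nat.cast_one] at h
  rw [← h]
  refine Finset.sum_congr rfl fun x hx => ?_
  rw [bcoef_eq_prodPrimeFactors (Nat.left_ne_zero_of_mem_divisorsAntidiagonal hx)]

lemma abscissaOfAbsConv_vonMangoldt_le :
    LSeries.abscissaOfAbsConv (fun n => (ArithmeticFunction.vonMangoldt n : ℂ)) ≤ 1 :=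
  LSeries.abscissaOfAbsConv_le_of_forall_lt_LSeriesSummable' fun y hy =>
    ArithmeticFunction.LSeriesSummable_vonMangoldt (by simpa using mod_cast hy)

lemma zetaLogDerivDeriv_eq_LSeries {s : ℂ} (hs : 1 < s.re) :
    zetaLogDerivDeriv s =
      LSeries (LSeries.logMul fun n => (ArithmeticFunction.vonMangoldt n : ℂ)) s := by
  have hd := (LSeries_hasDerivAt (s := s)
    (abscissaOfAbsConv_vonMangoldt_le.trans_lt (by exact_mod_cast hs))).neg
  rw [neg_neg] at hd
  refine (Filter.EventuallyEq.deriv_eq ?_).trans hd.deriv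
  filter_upwards [(isOpen_lt continuous_const continuous_re).mem_nhds hs] with z hz
  rw [Pi.neg_apply, ArithmeticFunction.LSeries_vonMangoldt_eq_deriv_riemannZeta_div hz]
  ring

/-- The terms of the double series obtained by expanding `(ζ'/ζ)'((m + 1) s)` as a Dirichlet
series in `n`. -/
noncomputable def bcoefTerm (s : ℂ) (x : ℕ × ℕ) : ℂ :=
  (bcoef (x.1 + 1) : ℂ) *
    LSeries.term (LSeries.logMul fun n => (ArithmeticFunction.vonMangoldt n : ℂ))
      ((x.1 + 1 : ℕ) * s) x.2

lemma bcoefTerm_of_ne_zero (s : ℂ) (m : ℕ) {n : ℕ} (hn : n ≠ 0) :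
    bcoefTerm s (m, n) = bcoef (m + 1) * (Real.log n * ArithmeticFunction.vonMangoldt n) /
      ((n ^ (m + 1) : ℕ) : ℂ) ^ s := by
  rw [bcoefTerm, LSeries.term_of_ne_zero hn, LSeries.logMul, natCast_cpow_natCast_mul,
    ofReal_log n.cast_nonneg, Nat.cast_pow, ofReal_natCast]
  ring

lemma isPrimePow_of_bcoefTerm_ne_zero {s : ℂ} {x : ℕ × ℕ} (h : bcoefTerm s x ≠ 0) :
    IsPrimePow x.2 := by
  rw [← ArithmeticFunction.vonMangoldt_ne_zero_iff]
  contrapose! h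
  simp [bcoefTerm, LSeries.term, LSeries.logMul, h]

lemma norm_bcoefTerm_le {s : ℂ} (hs : 1 < s.re) (m n : ℕ) :
    ‖bcoefTerm s (m, n)‖ ≤ ((m + 1 : ℕ) * (1 / 2 : ℝ) ^ m) *
      ‖LSeries.term (LSeries.logMul fun n => (ArithmeticFunction.vonMangoldt n : ℂ)) s n‖ := by
  by_cases h : bcoefTerm s (m, n) = 0
  · rw [h, norm_zero]
    positivity
  have hn := (isPrimePow_of_bcoefTerm_ne_zero h).two_le
  have hn0 : n ≠ 0 := by grind
  have hpos : 0 < n := by grind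
  have hb : ‖(bcoef (m + 1) : ℂ)‖ ≤ (m + 1 : ℕ) := by
    rw [norm_intCast]
    exact_mod_cast abs_bcoef_le m.succ_ne_zero
  have hpow : (2 : ℝ) ^ m ≤ ((n : ℝ) ^ s.re) ^ m := by
    gcongr
    calc (2 : ℝ) ≤ n := by exact_mod_cast hn
      _ = (n : ℝ) ^ (1 : ℝ) := (Real.rpow_one _).symm
      _ ≤ _ := Real.rpow_le_rpow_of_exponent_le (by exact_mod_cast hpos) hs.le
  have hns : 0 < (n : ℝ) ^ s.re := Real.rpow_pos_of_pos (by exact_mod_cast hpos) _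
  rw [bcoefTerm, norm_mul, mul_assoc]
  gcongr
  rw [LSeries.term_of_ne_zero hn0, LSeries.term_of_ne_zero hn0, norm_div, norm_div,
    cpow_nat_mul, norm_pow, norm_natCast_cpow_of_pos hpos, pow_succ, ← div_div,
    div_eq_mul_inv _ (_ ^ m), div_pow, one_pow, one_div, mul_comm _ (_ / _), mul_div_right_comm]
  gcongr

lemma summable_norm_bcoefTerm {s : ℂ} (hs : 1 < s.re) :
    Summable fun x => ‖bcoefTerm s x‖ := by
  have hgeom : Summable fun m : ℕ => ((m + 1 : ℕ) * (1 / 2 : ℝ) ^ m) := by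
    have h1 := summable_pow_mul_geometric_of_norm_lt_one 1 (r := (1 / 2 : ℝ)) (by norm_num)
    have h0 := summable_geometric_of_lt_one (r := (1 / 2 : ℝ)) (by norm_num) (by norm_num)
    refine (h1.add h0).congr fun m => ?_
    push_cast
    ring
  have hL : LSeriesSummable
      (LSeries.logMul fun n => (ArithmeticFunction.vonMangoldt n : ℂ)) s :=
    LSeriesSummable_logMul_of_lt_re
      (abscissaOfAbsConv_vonMangoldt_le.trans_lt (by exact_mod_cast hs))
  exact Summable.of_nonneg_of_le (fun _ => norm_nonneg _) (fun x => norm_bcoefTerm_le hs x.1 x.2)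
    (hgeom.mul_of_nonneg hL.norm (fun _ => by positivity) fun _ => norm_nonneg _)

lemma tsum_bcoefTerm_snd {s : ℂ} (hs : 1 < s.re) (m : ℕ) :
    ∑' n, bcoefTerm s (m, n) = bcoef (m + 1) * zetaLogDerivDeriv ((m + 1 : ℕ) * s) := by
  have hms : 1 < (((m + 1 : ℕ) : ℂ) * s).re := by
    rw [← ofReal_natCast, re_ofReal_mul]
    push_cast
    nlinarith [m.cast_nonneg (α := ℝ)]
  rw [zetaLogDerivDeriv_eq_LSeries hms, LSeries, ← tsum_mul_left]
  rfl

lemma tsum_bcoefTerm_fiber (s : ℂ) (N : ℕ) :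
    ∑' x : (fun x : ℕ × ℕ => x.2 ^ (x.1 + 1)) ⁻¹' {N}, bcoefTerm s x =
      (ArithmeticFunction.vonMangoldt N : ℂ) ^ 2 / (N : ℂ) ^ s := by
  by_cases hN : IsPrimePow N
  swap
  · rw [ArithmeticFunction.vonMangoldt_eq_zero_iff.mpr hN]
    simp only [ofReal_zero, ne_eq, OfNat.ofNat_ne_zero, not_false_eq_true, zero_pow, zero_div]
    refine (tsum_congr fun x => ?_).trans tsum_zero
    by_contra h
    have hx : x.1.2 ^ (x.1.1 + 1) = N := x.2
    exact hN (hx ▸ (isPrimePow_of_bcoefTerm_ne_zero h).pow (Nat.succ_ne_zero _))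
  obtain ⟨p, k, hp, hk, rfl⟩ := (isPrimePow_nat_iff _).mp hN
  have hinj : Set.InjOn (fun x : ℕ × ℕ => (x.1 - 1, p ^ x.2)) k.divisorsAntidiagonal := by
    intro x hx y hy hxy
    have h1 := Nat.left_ne_zero_of_mem_divisorsAntidiagonal hx
    have h2 := Nat.left_ne_zero_of_mem_divisorsAntidiagonal hy
    simp only [Prod.mk.injEq] at hxy
    have h3 := Nat.pow_right_injective hp.two_le hxy.2
    ext <;> grind
  rw [tsum_subtype, tsum_eq_sum (s := k.divisorsAntidiagonal.image
    fun x : ℕ × ℕ => (x.1 - 1, p ^ x.2)), Finset.sum_image hinj]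
  · have hterm : ∀ x ∈ k.divisorsAntidiagonal,
        ((fun x : ℕ × ℕ => x.2 ^ (x.1 + 1)) ⁻¹' {p ^ k}).indicator (bcoefTerm s)
          (x.1 - 1, p ^ x.2) =
        ((bcoef x.1 * (x.2 : ℤ) : ℤ) : ℂ) *
          ((ArithmeticFunction.vonMangoldt (p ^ k) : ℂ) ^ 2 / ((p ^ k : ℕ) : ℂ) ^ s) := by
      intro x hx
      have h1 := Nat.left_ne_zero_of_mem_divisorsAntidiagonal hx
      have h2 := Nat.right_ne_zero_of_mem_divisorsAntidiagonal hx
      have hx1 : x.1 - 1 + 1 = x.1 := Nat.succ_pred_eq_of_ne_zero h1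
      have hpow : (p ^ x.2) ^ (x.1 - 1 + 1) = p ^ k := by
        rw [hx1, ← pow_mul, mul_comm, (Nat.mem_divisorsAntidiagonal.mp hx).1]
      rw [Set.indicator_of_mem (by exact hpow),
        bcoefTerm_of_ne_zero _ _ (pow_ne_zero _ hp.ne_zero), hpow, hx1,
        ArithmeticFunction.vonMangoldt_apply_pow h2, ArithmeticFunction.vonMangoldt_apply_pow hk.ne',
        ArithmeticFunction.vonMangoldt_apply_prime hp, Nat.cast_pow, Real.log_pow]
      push_cast
      ring
    rw [Finset.sum_congr rfl hterm, ← Finset.sum_mul, ← Int.cast_sum,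
      sum_divisorsAntidiagonal_bcoef_mul hk.ne', Int.cast_one, one_mul]
  · rintro ⟨m, n⟩ hx
    rw [Set.indicator_apply_eq_zero]
    intro hmem
    by_contra hne
    have hmem : n ^ (m + 1) = p ^ k := hmem
    obtain ⟨j, -, rfl⟩ := (Nat.dvd_prime_pow hp).mp (hmem ▸ dvd_pow_self n m.succ_ne_zero)
    rw [← pow_mul] at hmem
    have hjk := Nat.pow_right_injective hp.two_le hmem
    refine hx (Finset.mem_image.mpr ⟨(m + 1, j), ?_, by simp⟩)
    rw [Nat.mem_divisorsAntidiagonal]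
    exact ⟨by rw [← hjk, mul_comm], hk.ne'⟩

/-- For `Re s > 1`, `∑_{n≥1} Λ(n)²/n^s = ∑_{m≥1} b_m (ζ'/ζ)'(ms)`, the series on the right
converging absolutely. -/
theorem vonMangoldt_sq_eq_sum_bcoef (s : ℂ) (hs : 1 < s.re) :
    Summable (fun m : ℕ => ‖(bcoef (m + 1) : ℂ) * zetaLogDerivDeriv ((m + 1 : ℕ) * s)‖) ∧
    ∑' n : ℕ, (ArithmeticFunction.vonMangoldt n : ℂ) ^ 2 / (n : ℂ) ^ s =
      ∑' m : ℕ, (bcoef (m + 1) : ℂ) * zetaLogDerivDeriv ((m + 1 : ℕ) * s) := by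
  have hnorm := summable_norm_bcoefTerm hs
  have hsum : Summable (bcoefTerm s) := hnorm.of_norm
  simp_rw [← tsum_bcoefTerm_snd hs, ← tsum_bcoefTerm_fiber s]
  refine ⟨hnorm.prod.of_nonneg_of_le (fun _ => norm_nonneg _) fun m =>
    norm_tsum_le_tsum_norm (hnorm.prod_factor m), ?_⟩
  rw [← hsum.tsum_prod]
  exact (hsum.hasSum.tsum_fiberwise _).tsum_eq
end

section
/- For every positive integer k, ∑_{m | k} (k/m)·b_m = 1, where b_m = μ(rad m)·φ(rad m). -/
theorem Nat.rad_mul {m n : ℕ} (h : m.Coprime n) : (m * n).rad = m.rad * n.rad := by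
  unfold Nat.rad
  rw [h.primeFactors_mul, Finset.prod_union h.disjoint_primeFactors]

theorem Nat.rad_prime_pow {p j : ℕ} (hp : p.Prime) (hj : j ≠ 0) : (p ^ j).rad = p := by
  rw [Nat.rad, Nat.primeFactors_prime_pow hj hp, Finset.prod_singleton]

theorem Nat.Coprime.rad {m n : ℕ} (h : m.Coprime n) : m.rad.Coprime n.rad :=
  (h.coprime_dvd_left (Nat.prod_primeFactors_dvd m)).coprime_dvd_right
    (Nat.prod_primeFactors_dvd n)

theorem bcoef_one : bcoef 1 = 1 := by
  simp [bcoef, Nat.rad]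

theorem bcoef_mul {m n : ℕ} (h : m.Coprime n) : bcoef (m * n) = bcoef m * bcoef n := by
  unfold bcoef
  rw [Nat.rad_mul h, ArithmeticFunction.isMultiplicative_moebius.map_mul_of_coprime h.rad,
    Nat.totient_mul h.rad]
  push_cast
  ring

theorem bcoef_prime_pow {p j : ℕ} (hp : p.Prime) (hj : j ≠ 0) :
    bcoef (p ^ j) = 1 - (p : ℤ) := by
  rw [bcoef, Nat.rad_prime_pow hp hj, ArithmeticFunction.moebius_apply_prime hp,
    Nat.totient_prime hp, Nat.cast_sub hp.one_le]
  push_cast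
  ring

/-- `bcoef` as an arithmetic function, with value `0` at `0`. -/
noncomputable def bcoefArith : ArithmeticFunction ℤ :=
  ⟨fun m => if m = 0 then 0 else bcoef m, if_pos rfl⟩

theorem bcoefArith_apply {m : ℕ} (hm : m ≠ 0) : bcoefArith m = bcoef m :=
  if_neg hm

theorem isMultiplicative_bcoefArith : bcoefArith.IsMultiplicative := by
  rw [ArithmeticFunction.IsMultiplicative.iff_ne_zero]
  refine ⟨by rw [bcoefArith_apply one_ne_zero, bcoef_one], fun {m n} hm hn h => ?_⟩
  rw [bcoefArith_apply hm, bcoefArith_apply hn, bcoefArith_apply (mul_ne_zero hm hn), bcoef_mul h]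

theorem bcoefArith_mul_id_apply {k : ℕ} :
    (bcoefArith * (ArithmeticFunction.id : ArithmeticFunction ℤ)) k =
      ∑ m ∈ k.divisors, ((k / m : ℕ) : ℤ) * bcoef m := by
  rw [ArithmeticFunction.mul_apply,
    Nat.sum_divisorsAntidiagonal (fun i j => bcoefArith i *
      (ArithmeticFunction.id : ArithmeticFunction ℤ) j)]
  refine Finset.sum_congr rfl fun m hm => ?_
  rw [bcoefArith_apply (Nat.pos_of_mem_divisors hm).ne', mul_comm]
  simp

theorem sum_div_mul_bcoef_prime_pow {p : ℕ} (hp : p.Prime) (a : ℕ) :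
    ∑ m ∈ (p ^ a).divisors, ((p ^ a / m : ℕ) : ℤ) * bcoef m = 1 := by
  rw [Nat.sum_divisors_prime_pow hp]
  induction a with
  | zero => simp [bcoef_one]
  | succ a ih =>
    have key : ∀ j ∈ Finset.range (a + 1),
        ((p ^ (a + 1) / p ^ j : ℕ) : ℤ) * bcoef (p ^ j) =
          p * (((p ^ a / p ^ j : ℕ) : ℤ) * bcoef (p ^ j)) := fun j hj => by
      have hj : j ≤ a := Nat.lt_succ_iff.mp (Finset.mem_range.mp hj)
      rw [pow_succ', Nat.mul_div_assoc _ (pow_dvd_pow p hj), Nat.cast_mul, mul_assoc]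
    rw [Finset.sum_range_succ, Finset.sum_congr rfl key, ← Finset.mul_sum, ih,
      Nat.div_self (pow_pos hp.pos _), bcoef_prime_pow hp a.succ_ne_zero]
    push_cast
    ring

theorem bcoefArith_mul_id :
    bcoefArith * (ArithmeticFunction.id : ArithmeticFunction ℤ) =
      (ArithmeticFunction.zeta : ArithmeticFunction ℤ) := by
  refine (ArithmeticFunction.IsMultiplicative.eq_iff_eq_on_prime_powers _
    (isMultiplicative_bcoefArith.mul ArithmeticFunction.isMultiplicative_id.natCast) _
    ArithmeticFunction.isMultiplicative_zeta.natCast).mpr fun p a hp => ?_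
  rw [bcoefArith_mul_id_apply, sum_div_mul_bcoef_prime_pow hp,
    ArithmeticFunction.natCoe_apply, ArithmeticFunction.zeta_apply_ne (pow_pos hp.pos a).ne',
    Nat.cast_one]

/-- For every positive integer `k`, `∑_{m ∣ k} (k/m)·b_m = 1`. -/
theorem sum_div_mul_bcoef (k : ℕ) (hk : 0 < k) :
    ∑ m ∈ k.divisors, ((k / m : ℕ) : ℤ) * bcoef m = 1 := by
  rw [← bcoefArith_mul_id_apply, bcoefArith_mul_id, ArithmeticFunction.natCoe_apply,
    ArithmeticFunction.zeta_apply_ne hk.ne', Nat.cast_one]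
end
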